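/- Let (φ,ε) be a consistent CCTLv closure and let K be the maximal integer constant occurring in a constraint of φ or of a formula in the range of ε. For every Kripke structure S, every state q of S and all valuations v, v' defined on dom(ε): if v_K = v'_K (i.e., v(z) ≤ K implies v(z) = v'(z) and v'(z) ≤ K implies v'(z) = v(z) for all z), then (q,v,ε) ⊨_S φ iff (q,v',ε) ⊨_S φ. -/

import Mathlib

open scoped Classical

noncomputable section

/-- A Kripke structure with states `Q` and atomic propositions `AP`. -/
structure Kripke (Q AP : Type) where
  R : Q → Q → Prop
  total : ∀ q, ∃ q', R q q'
  label : Q → AP → Prop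

/-- An (infinite) run of a Kripke structure. -/
def Kripke.Run {Q AP : Type} (S : Kripke Q AP) (ρ : ℕ → Q) : Prop :=
  ∀ i, S.R (ρ i) (ρ (i + 1))

/-- The strict prefix `ρ(0) ⋯ ρ(n-1)` of a run (`n` states). -/
def runPrefix {Q : Type} (ρ : ℕ → Q) (n : ℕ) : List Q :=
  (List.range n).map ρ

/-- Comparison operators `<, ≤, =, ≥, >`. -/
inductive Cmp where
  | lt | le | eq | ge | gt

def Cmp.eval : Cmp → ℕ → ℕ → Prop
  | .lt, a, b => a < b
  | .le, a, b => a ≤ b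
  | .eq, a, b => a = b
  | .ge, a, b => a ≥ b
  | .gt, a, b => a > b

/-- CCTLv formulas over atomic propositions `AP` and variables in `ℕ`:
`P | φ∨ψ | ¬φ | EφUψ | AφUψ | z[ψ].φ | Σᵢ αᵢ·zᵢ ∼ c`.
A constraint is a list of (coefficient, variable) pairs together with a
comparison and a constant. -/
inductive VForm (AP : Type) : Type where
  | atom : AP → VForm AP
  | or : VForm AP → VForm AP → VForm AP
  | not : VForm AP → VForm AP
  | eu : VForm AP → VForm AP → VForm AP
  | au : VForm AP → VForm AP → VForm AP
  | bind : ℕ → VForm AP → VForm AP → VForm AP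
  | constr : List (ℕ × ℕ) → Cmp → ℕ → VForm AP

/-- Value `Σᵢ αᵢ·v(zᵢ)` of a constraint expression under a valuation. -/
def lvval (l : List (ℕ × ℕ)) (v : ℕ → ℕ) : ℕ :=
  (l.map (fun t => t.1 * v t.2)).sum

mutual
/-- Satisfaction `(q,v,ε) ⊨ φ` of a CCTLv formula at a state `q`, under a
valuation `v` and an environment `ε`.  The auxiliary bound `k` is a strict
upper bound on the variables in play: along a run, all (defined) variables
`z < k` are updated according to whether `ε(z)` holds at each state; since
(by consistency) the formula bound to a variable only uses smaller
variables, this computes exactly the semantics of the logic. -/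
def vsat {Q AP : Type} (S : Kripke Q AP) :
    ℕ → VForm AP → Q → (ℕ → ℕ) → (ℕ → Option (VForm AP)) → Prop
  | _, .atom p, q, _, _ => S.label q p
  | k, .or φ ψ, q, v, ε => vsat S k φ q v ε ∨ vsat S k ψ q v ε
  | k, .not φ, q, v, ε => ¬ vsat S k φ q v ε
  | _, .constr l c n, _, v, _ => c.eval (lvval l v) n
  | k, .bind z ψ φ, q, v, ε =>
      vsat S k φ q (Function.update v z 0) (Function.update ε z (some ψ))
  | k, .eu φ ψ, q, v, ε => ∃ ρ, S.Run ρ ∧ ρ 0 = q ∧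
      ∃ i, vsat S k ψ (ρ i) (updAlong S k v ε (runPrefix ρ i)) ε ∧
        ∀ j < i, vsat S k φ (ρ j) (updAlong S k v ε (runPrefix ρ j)) ε
  | k, .au φ ψ, q, v, ε => ∀ ρ, S.Run ρ → ρ 0 = q →
      ∃ i, vsat S k ψ (ρ i) (updAlong S k v ε (runPrefix ρ i)) ε ∧
        ∀ j < i, vsat S k φ (ρ j) (updAlong S k v ε (runPrefix ρ j)) ε
termination_by k φ _ _ _ => (k, sizeOf φ, 0)

/-- The valuation `v +_ε π`: update `v` along the finite prefix `π`. -/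
def updAlong {Q AP : Type} (S : Kripke Q AP) :
    ℕ → (ℕ → ℕ) → (ℕ → Option (VForm AP)) → List Q → (ℕ → ℕ)
  | _, v, _, [] => v
  | k, v, ε, r :: t => updAlong S k (updOne S k v ε r) ε t
termination_by k _ _ σ => (k, 0, sizeOf σ)

/-- One update step: each defined variable `z` is incremented iff `ε(z)`
holds at the state `r`. -/
def updOne {Q AP : Type} (S : Kripke Q AP) (k : ℕ) (v : ℕ → ℕ)
    (ε : ℕ → Option (VForm AP)) (r : Q) : ℕ → ℕ :=
  fun z => if h : z < k ∧ (ε z).isSome then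
      (if vsat S z ((ε z).get h.2) r v ε then v z + 1 else v z)
    else v z
termination_by (k, 0, 0)
end

/-- All variables occurring in a formula. -/
def VForm.vars {AP : Type} : VForm AP → Finset ℕ
  | .atom _ => ∅
  | .or φ ψ => φ.vars ∪ ψ.vars
  | .not φ => φ.vars
  | .eu φ ψ => φ.vars ∪ ψ.vars
  | .au φ ψ => φ.vars ∪ ψ.vars
  | .bind z ψ φ => insert z (ψ.vars ∪ φ.vars)
  | .constr l _ _ => (l.map Prod.snd).toFinset

/-- The free variables of a formula. -/
def VForm.FV {AP : Type} : VForm AP → Finset ℕ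
  | .atom _ => ∅
  | .or φ ψ => φ.FV ∪ ψ.FV
  | .not φ => φ.FV
  | .eu φ ψ => φ.FV ∪ ψ.FV
  | .au φ ψ => φ.FV ∪ ψ.FV
  | .bind z ψ φ => ψ.FV ∪ (φ.FV \ {z})
  | .constr l _ _ => (l.map Prod.snd).toFinset

/-- The bound variables of a formula. -/
def VForm.BV {AP : Type} : VForm AP → Finset ℕ
  | .atom _ => ∅
  | .or φ ψ => φ.BV ∪ ψ.BV
  | .not φ => φ.BV
  | .eu φ ψ => φ.BV ∪ ψ.BV
  | .au φ ψ => φ.BV ∪ ψ.BV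
  | .bind z ψ φ => insert z (ψ.BV ∪ φ.BV)
  | .constr _ _ _ => ∅

/-- Syntactic well-formedness of CCTLv formulas: every variable is bound
at most once, and in `z[ψ].φ` the formula `ψ` only uses variables `≺ z`
(we take `≺` to be `<` on `ℕ`). -/
def VForm.WF {AP : Type} : VForm AP → Prop
  | .atom _ => True
  | .or φ ψ => φ.WF ∧ ψ.WF ∧ Disjoint φ.BV ψ.BV
  | .not φ => φ.WF
  | .eu φ ψ => φ.WF ∧ ψ.WF ∧ Disjoint φ.BV ψ.BV
  | .au φ ψ => φ.WF ∧ ψ.WF ∧ Disjoint φ.BV ψ.BV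
  | .bind z ψ φ => ψ.WF ∧ φ.WF ∧ z ∉ ψ.BV ∧ z ∉ φ.BV ∧
      Disjoint ψ.BV φ.BV ∧ ∀ z' ∈ ψ.vars, z' < z
  | .constr _ _ _ => True

/-- The maximal integer constant occurring in a constraint of a formula. -/
def VForm.maxConst {AP : Type} : VForm AP → ℕ
  | .atom _ => 0
  | .or φ ψ => max φ.maxConst ψ.maxConst
  | .not φ => φ.maxConst
  | .eu φ ψ => max φ.maxConst ψ.maxConst
  | .au φ ψ => max φ.maxConst ψ.maxConst
  | .bind _ ψ φ => max ψ.maxConst φ.maxConst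
  | .constr _ _ c => c

/-- Consistency of a closure `(φ, ε)` (Definition of consistent closures):
`ε` is defined on the variables of `φ` exactly on `FV(φ)`, refers only to
defined variables, and is acyclic with respect to `<`. -/
def Consistent {AP : Type} (φ : VForm AP) (ε : ℕ → Option (VForm AP)) : Prop :=
  (∀ z ∈ φ.vars, ((ε z).isSome ↔ z ∈ φ.FV)) ∧
  (∀ z ψ, ε z = some ψ → ∀ z' ∈ ψ.FV, (ε z').isSome) ∧
  (∀ z ψ, ε z = some ψ → ∀ z' ∈ ψ.vars, z' < z)

theorem VForm.FV_subset_vars {AP : Type} (φ : VForm AP) : φ.FV ⊆ φ.vars := by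
  induction φ with
  | atom p => simp [VForm.FV]
  | not φ ih => simpa only [VForm.FV, VForm.vars] using ih
  | constr l c n => simp [VForm.FV, VForm.vars]
  | or φ ψ ihφ ihψ | eu φ ψ ihφ ihψ | au φ ψ ihφ ihψ =>
    simpa only [VForm.FV, VForm.vars] using Finset.union_subset_union ihφ ihψ
  | bind z ψ φ ihψ ihφ =>
    intro x hx
    simp only [VForm.FV, VForm.vars, Finset.mem_union, Finset.mem_insert, Finset.mem_sdiff] at hx ⊢
    rcases hx with hx | ⟨hx, -⟩
    · exact Or.inr (Or.inl (ihψ hx))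
    · exact Or.inr (Or.inr (ihφ hx))

/-- `m` and `n` are equal, or both exceed the bound `K`. -/
def EqUpTo (K m n : ℕ) : Prop := (m ≤ K → m = n) ∧ (n ≤ K → m = n)

theorem EqUpTo.refl (K m : ℕ) : EqUpTo K m m := ⟨fun _ => rfl, fun _ => rfl⟩

theorem EqUpTo.add {K a b c d : ℕ} (h : EqUpTo K a b) (h' : EqUpTo K c d) :
    EqUpTo K (a + c) (b + d) := by
  unfold EqUpTo at *
  omega

theorem EqUpTo.mul_left {K m n : ℕ} (a : ℕ) (h : EqUpTo K m n) : EqUpTo K (a * m) (a * n) := by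
  induction a with
  | zero => simpa using EqUpTo.refl K 0
  | succ a ih => simpa only [Nat.succ_mul] using ih.add h

theorem EqUpTo.lvval {K : ℕ} {v v' : ℕ → ℕ} {l : List (ℕ × ℕ)}
    (h : ∀ z ∈ l.map Prod.snd, EqUpTo K (v z) (v' z)) : EqUpTo K (lvval l v) (lvval l v') := by
  induction l with
  | nil => exact EqUpTo.refl K 0
  | cons t l ih =>
    simp only [List.map_cons, List.mem_cons, forall_eq_or_imp] at h
    exact (h.1.mul_left t.1).add (ih h.2)

theorem EqUpTo.eval_iff {K m n c : ℕ} (h : EqUpTo K m n) (hc : c ≤ K) (r : Cmp) :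
    r.eval m c ↔ r.eval n c := by
  unfold EqUpTo at h
  cases r <;> simp only [Cmp.eval] <;> omega

/-- Every formula in the range of `ε` only has free variables defined by `ε`, and constants bounded
by `K`. -/
def EnvBounded {AP : Type} (K : ℕ) (ε : ℕ → Option (VForm AP)) : Prop :=
  ∀ z ψ, ε z = some ψ → (∀ z' ∈ ψ.FV, (ε z').isSome) ∧ ψ.maxConst ≤ K

/-- The valuations `v` and `v'` agree up to `K` on the variables defined by `ε`. -/
def ValEqUpTo {AP : Type} (K : ℕ) (ε : ℕ → Option (VForm AP)) (v v' : ℕ → ℕ) : Prop :=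
  ∀ z, (ε z).isSome → EqUpTo K (v z) (v' z)

/-- Satisfaction at level `k` of formulas with constants bounded by `K` does not distinguish
valuations that agree up to `K`. -/
def VsatInvariant {Q AP : Type} (S : Kripke Q AP) (K k : ℕ) (φ : VForm AP) : Prop :=
  ∀ (ε : ℕ → Option (VForm AP)) (q : Q) (v v' : ℕ → ℕ), EnvBounded K ε →
    (∀ z ∈ φ.FV, (ε z).isSome) → φ.maxConst ≤ K → ValEqUpTo K ε v v' →
    (vsat S k φ q v ε ↔ vsat S k φ q v' ε)

theorem isSome_update_some {α : Type} {ε : ℕ → Option α} {z x : ℕ} (a : α)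
    (h : x ≠ z → (ε x).isSome) : (Function.update ε z (some a) x).isSome := by
  by_cases hx : x = z
  · simp [hx]
  · simpa [hx] using h hx

theorem EnvBounded.update {AP : Type} {K : ℕ} {ε : ℕ → Option (VForm AP)} (hε : EnvBounded K ε)
    (z : ℕ) {ψ : VForm AP} (hψ : ∀ x ∈ ψ.FV, (ε x).isSome) (hK : ψ.maxConst ≤ K) :
    EnvBounded K (Function.update ε z (some ψ)) := by
  intro x χ hχ
  have key : (∀ y ∈ χ.FV, (ε y).isSome) ∧ χ.maxConst ≤ K := by
    by_cases hx : x = z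
    · subst hx
      simp only [Function.update_self, Option.some.injEq] at hχ
      exact hχ ▸ ⟨hψ, hK⟩
    · exact hε x χ (by simpa [hx] using hχ)
  exact ⟨fun y hy => isSome_update_some ψ fun _ => key.1 y hy, key.2⟩

theorem ValEqUpTo.update {AP : Type} {K : ℕ} {ε : ℕ → Option (VForm AP)} {v v' : ℕ → ℕ}
    (h : ValEqUpTo K ε v v') (z n : ℕ) (a : Option (VForm AP)) :
    ValEqUpTo K (Function.update ε z a) (Function.update v z n) (Function.update v' z n) := by
  intro x hx
  by_cases hxz : x = z
  · simpa [hxz] using EqUpTo.refl K n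
  · simpa [hxz] using h x (by simpa [hxz] using hx)

section Update

variable {Q AP : Type} {S : Kripke Q AP} {K k : ℕ} {ε : ℕ → Option (VForm AP)} {v v' : ℕ → ℕ}

theorem ValEqUpTo.updOne (ih : ∀ m < k, ∀ ψ, VsatInvariant S K m ψ) (hε : EnvBounded K ε)
    (h : ValEqUpTo K ε v v') (r : Q) :
    ValEqUpTo K ε (updOne S k v ε r) (updOne S k v' ε r) := by
  intro z hz
  by_cases hzk : z < k
  · obtain ⟨ψ, hψ⟩ := Option.isSome_iff_exists.mp hz
    have hiff := ih z hzk ψ ε r v v' hε (hε z ψ hψ).1 (hε z ψ hψ).2 h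
    have hget : (ε z).get hz = ψ := by simp [hψ]
    rw [_root_.updOne, _root_.updOne]
    simp only [hzk, hz, and_self, dite_true, hget, hiff]
    split_ifs
    · exact (h z hz).add (EqUpTo.refl K 1)
    · exact h z hz
  · rw [_root_.updOne, _root_.updOne]
    simpa [hzk] using h z hz

theorem ValEqUpTo.updAlong (ih : ∀ m < k, ∀ ψ, VsatInvariant S K m ψ) (hε : EnvBounded K ε)
    (h : ValEqUpTo K ε v v') (π : List Q) :
    ValEqUpTo K ε (updAlong S k v ε π) (updAlong S k v' ε π) := by
  induction π generalizing v v' with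
  | nil => simpa only [_root_.updAlong] using h
  | cons r t iht => simpa only [_root_.updAlong] using iht (h.updOne ih hε r)

end Update

theorem vsatInvariant {Q AP : Type} (S : Kripke Q AP) (K k : ℕ) (φ : VForm AP) :
    VsatInvariant S K k φ := by
  induction k using Nat.strong_induction_on generalizing φ with
  | _ k ih =>
  induction φ with
  | atom p =>
    intro ε q v v' _ _ _ _
    simp only [vsat]
  | not φ ihφ =>
    intro ε q v v' hε hfv hK h
    simp only [vsat]
    exact not_congr (ihφ ε q v v' hε hfv hK h)
  | constr l c n =>
    intro ε q v v' _ hfv hK h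
    simp only [vsat]
    exact (EqUpTo.lvval fun z hz =>
      h z (hfv z (by simpa only [VForm.FV, List.mem_toFinset] using hz))).eval_iff hK c
  | or φ ψ ihφ ihψ =>
    intro ε q v v' hε hfv hK h
    simp only [VForm.FV, Finset.mem_union, or_imp, forall_and] at hfv
    simp only [VForm.maxConst, max_le_iff] at hK
    simp only [vsat]
    exact or_congr (ihφ ε q v v' hε hfv.1 hK.1 h) (ihψ ε q v v' hε hfv.2 hK.2 h)
  | eu φ ψ ihφ ihψ | au φ ψ ihφ ihψ =>
    intro ε q v v' hε hfv hK h
    simp only [VForm.FV, Finset.mem_union, or_imp, forall_and] at hfv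
    simp only [VForm.maxConst, max_le_iff] at hK
    have hφ r π := ihφ ε r _ _ hε hfv.1 hK.1 (h.updAlong ih hε π)
    have hψ r π := ihψ ε r _ _ hε hfv.2 hK.2 (h.updAlong ih hε π)
    simp only [vsat, hφ, hψ]
  | bind z ψ φ ihψ ihφ =>
    intro ε q v v' hε hfv hK h
    simp only [VForm.FV, Finset.mem_union, Finset.mem_sdiff, Finset.mem_singleton, or_imp,
      forall_and] at hfv
    simp only [VForm.maxConst, max_le_iff] at hK
    simp only [vsat]
    exact ihφ _ q _ _ (hε.update z hfv.1 hK.1)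
      (fun x hx => isSome_update_some ψ fun hxz => hfv.2 x ⟨hx, hxz⟩) hK.2 (h.update z 0 _)

/-- if `K` bounds every constant occurring in `φ` or in the
range of `ε` (in particular if `K` is the maximal such constant), then two
valuations `v, v'` that agree on all variables with value `≤ K`
(`v_K = v'_K`) satisfy exactly the same consistent closures `(φ, ε)`. -/
theorem vsat_bounded_valuation
    {Q AP : Type} [Fintype Q] (S : Kripke Q AP)
    (φ : VForm AP) (ε : ℕ → Option (VForm AP))
    (hwf : φ.WF) (hcons : Consistent φ ε)
    (K : ℕ)
    (hKφ : φ.maxConst ≤ K)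
    (hKε : ∀ z ψ, ε z = some ψ → ψ.maxConst ≤ K)
    (k : ℕ) (hkφ : ∀ z ∈ φ.vars, z < k) (hkε : ∀ z, (ε z).isSome → z < k)
    (q : Q) (v v' : ℕ → ℕ)
    (hvv' : ∀ z, (ε z).isSome →
      (v z ≤ K → v z = v' z) ∧ (v' z ≤ K → v z = v' z)) :
    vsat S k φ q v ε ↔ vsat S k φ q v' ε := by
  exact vsatInvariant S K k φ ε q v v'
    (fun z ψ hz => ⟨hcons.2.1 z ψ hz, hKε z ψ hz⟩)
    (fun z hz => (hcons.1 z (φ.FV_subset_vars hz)).mpr hz) hKφ hvv'
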